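/- There is no regular subgroup of SL(3,ℝ) isomorphic to ℤ² ∗ ℤ. Precisely: there is no group homomorphism φ from the free product (ℤ × ℤ) ∗ ℤ to SL(3,ℝ) such that φ is injective and regular, i.e., such that for every sequence (w_k) of pairwise distinct elements of (ℤ × ℤ) ∗ ℤ, the sequence (φ(w_k)) is a regular sequence in SL(3,ℝ). -/

import Mathlib

open Filter

/-- Frobenius (entrywise ℓ²) norm of a 3×3 real matrix. -/
noncomputable def frobNorm (g : Matrix (Fin 3) (Fin 3) ℝ) : ℝ :=
  Real.sqrt (∑ i, ∑ j, (g i j) ^ 2)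

/-- A sequence in SL(3,ℝ) is regular if ‖gₙ‖²/‖gₙ⁻¹‖ → ∞. -/
def IsRegularSeq (g : ℕ → Matrix.SpecialLinearGroup (Fin 3) ℝ) : Prop :=
  Tendsto (fun n => (frobNorm ↑(g n)) ^ 2 / frobNorm ↑((g n)⁻¹)) atTop atTop

/-- A homomorphism is regular if it sends every sequence of pairwise distinct
elements to a regular sequence. -/
def IsRegularHom {Γ : Type*} [Group Γ]
    (ρ : Γ →* Matrix.SpecialLinearGroup (Fin 3) ℝ) : Prop :=
  ∀ γ : ℕ → Γ, Function.Injective γ → IsRegularSeq fun n => ρ (γ n)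


namespace RegZ2

abbrev Mat := Matrix (Fin 3) (Fin 3) ℝ

abbrev A2 := Multiplicative (ℤ × ℤ)

attribute [local instance] Matrix.frobeniusNormedAddCommGroup Matrix.frobeniusNormedSpace
  Matrix.frobeniusNormedRing Matrix.frobeniusNormedAlgebra

lemma frob_eq (g : Mat) : frobNorm g = ‖g‖ := by
  rw [Matrix.frobenius_norm_def, frobNorm, Real.sqrt_eq_rpow]
  simp

lemma entry_le (g : Mat) (i j : Fin 3) : |g i j| ≤ ‖g‖ := by
  rw [← frob_eq, frobNorm]
  apply Real.abs_le_sqrt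
  calc (g i j) ^ 2 ≤ ∑ j, (g i j) ^ 2 :=
        Finset.single_le_sum (f := fun j => (g i j) ^ 2) (fun _ _ => sq_nonneg _) (Finset.mem_univ j)
    _ ≤ _ := Finset.single_le_sum (f := fun i => ∑ j, (g i j) ^ 2)
        (fun _ _ => Finset.sum_nonneg fun _ _ => sq_nonneg _) (Finset.mem_univ i)

lemma le_entry (g : Mat) (K : ℝ) (h : ∀ i j, |g i j| ≤ K) : ‖g‖ ≤ 3 * K := by
  have hK : 0 ≤ K := (abs_nonneg _).trans (h 0 0)
  rw [← frob_eq, frobNorm]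
  apply Real.sqrt_le_iff.2 ⟨by positivity, ?_⟩
  have h2 : ∀ i j, (g i j) ^ 2 ≤ K ^ 2 := fun i j => sq_le_sq' (by linarith [(abs_le.1 (h i j)).1]) (abs_le.1 (h i j)).2
  calc _ ≤ ∑ i : Fin 3, ∑ j : Fin 3, K ^ 2 := Finset.sum_le_sum fun i _ => Finset.sum_le_sum fun j _ => h2 i j
    _ = _ := by simp; ring

lemma one_le_norm_one : (1:ℝ) ≤ ‖(1:Mat)‖ := by
  have := entry_le 1 0 0
  simpa using this

def RegH {G : Type*} [Group G] (ρ : G →* Mat) : Prop :=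
  ∀ C : ℝ, {γ | ‖ρ γ‖ ^ 2 ≤ C * ‖ρ γ⁻¹‖}.Finite

section
variable {G : Type*} [Group G] {ρ : G →* Mat}

lemma mul_inv_rho (ρ : G →* Mat) (γ : G) : ρ γ * ρ γ⁻¹ = 1 := by rw [← map_mul]; simp

lemma RegH.bdd (h : RegH ρ) (B : ℝ) : {γ | ‖ρ γ‖ ≤ B}.Finite := by
  refine (h (B ^ 3)).subset ?_
  intro γ hγ
  simp only [Set.mem_ofPred_eq] at *
  have h1 : 1 ≤ ‖ρ γ‖ * ‖ρ γ⁻¹‖ := by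
    refine one_le_norm_one.trans ?_
    rw [← mul_inv_rho ρ γ]; exact norm_mul_le _ _
  have h0 := norm_nonneg (ρ γ)
  have h0' := norm_nonneg (ρ γ⁻¹)
  have h2 : 1 ≤ B * ‖ρ γ⁻¹‖ := h1.trans (by gcongr)
  calc ‖ρ γ‖ ^ 2 ≤ B ^ 2 * 1 := by rw [mul_one]; gcongr
    _ ≤ B ^ 2 * (B * ‖ρ γ⁻¹‖) := by gcongr
    _ = _ := by ring

lemma RegH.bdd_inv (h : RegH ρ) (C : ℝ) : ∃ B, ∀ γ, ‖ρ γ‖ ^ 2 ≤ C * ‖ρ γ⁻¹‖ → ‖ρ γ⁻¹‖ ≤ B := by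
  obtain ⟨B, hB⟩ := ((h C).image (fun γ => ‖ρ γ⁻¹‖)).bddAbove
  exact ⟨B, fun γ hγ => hB ⟨γ, hγ, rfl⟩⟩

def conj (ρ : G →* Mat) (S T : Mat) (h : S * T = 1) : G →* Mat where
  toFun γ := T * ρ γ * S
  map_one' := by simp [mul_eq_one_comm.1 h]
  map_mul' a b := by
    rw [map_mul]
    calc T * (ρ a * ρ b) * S = T * ρ a * 1 * ρ b * S := by simp [mul_assoc]
      _ = _ := by rw [← h]; simp only [mul_assoc]

lemma RegH.conj (h : RegH ρ) (S T : Mat) (hS : S * T = 1) : RegH (conj ρ S T hS) := by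
  intro C
  refine (h (|C| * (‖S‖ * ‖T‖) ^ 3)).subset ?_
  intro γ hγ
  simp only [Set.mem_ofPred_eq] at *
  have e1 : ‖ρ γ‖ ≤ ‖S‖ * ‖RegZ2.conj ρ S T hS γ‖ * ‖T‖ := by
    have : ρ γ = S * RegZ2.conj ρ S T hS γ * T := by
      change ρ γ = S * (T * ρ γ * S) * T
      calc ρ γ = 1 * ρ γ * 1 := by simp
        _ = _ := by rw [← hS]; simp only [mul_assoc]
    rw [this]
    refine (norm_mul_le _ _).trans ?_
    gcongr
    exact norm_mul_le _ _
  have e2 : ‖RegZ2.conj ρ S T hS γ⁻¹‖ ≤ ‖T‖ * ‖ρ γ⁻¹‖ * ‖S‖ := by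
    change ‖T * ρ γ⁻¹ * S‖ ≤ _
    refine (norm_mul_le _ _).trans ?_
    gcongr
    exact (norm_mul_le _ _)
  calc ‖ρ γ‖ ^ 2 ≤ (‖S‖ * ‖RegZ2.conj ρ S T hS γ‖ * ‖T‖) ^ 2 := by gcongr
    _ = (‖S‖ * ‖T‖) ^ 2 * ‖RegZ2.conj ρ S T hS γ‖ ^ 2 := by ring
    _ ≤ (‖S‖ * ‖T‖) ^ 2 * (C * ‖RegZ2.conj ρ S T hS γ⁻¹‖) := by gcongr
    _ ≤ (‖S‖ * ‖T‖) ^ 2 * (|C| * (‖T‖ * ‖ρ γ⁻¹‖ * ‖S‖)) := by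
        gcongr
        exact le_abs_self C
    _ = _ := by ring

def dual (ρ : G →* Mat) : G →* Mat where
  toFun γ := (ρ γ⁻¹).transpose
  map_one' := by simp
  map_mul' a b := by simp [Matrix.transpose_mul]

lemma norm_transpose (g : Mat) : ‖g.transpose‖ = ‖g‖ := by
  rw [← frob_eq, ← frob_eq, frobNorm, frobNorm, Finset.sum_comm]
  rfl

lemma RegH.dual (h : RegH ρ) : RegH (dual ρ) := by
  intro C
  refine ((h C).image (fun γ => γ⁻¹)).subset ?_
  intro γ hγ
  refine ⟨γ⁻¹, ?_, by simp⟩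
  change ‖(ρ γ⁻¹).transpose‖ ^ 2 ≤ C * ‖(ρ γ⁻¹⁻¹).transpose‖ at hγ
  rw [norm_transpose, norm_transpose] at hγ
  exact hγ

lemma RegH.comp {H : Type*} [Group H] (h : RegH ρ) (ι : H →* G) (hι : Function.Injective ι) :
    RegH (ρ.comp ι) := by
  intro C
  refine ((h C).preimage (f := ι) hι.injOn).subset ?_
  intro γ hγ
  simpa using hγ

end

/-! Lattice lemmas -/

def pt (m n : ℤ) : A2 := Multiplicative.ofAdd (m, n)

lemma add_form (x : A2 → ℝ) (hx : ∀ a b, x (a * b) = x a + x b) :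
    ∃ r s : ℝ, ∀ m n : ℤ, x (pt m n) = m * r + n * s := by
  let X : ℤ × ℤ →+ ℝ := AddMonoidHom.mk' (fun p => x (Multiplicative.ofAdd p))
    (fun a b => by rw [ofAdd_add, hx])
  refine ⟨X (1, 0), X (0, 1), fun m n => ?_⟩
  have : ((m, n) : ℤ × ℤ) = m • (1, 0) + n • (0, 1) := by ext <;> simp
  change X (m, n) = _
  rw [this, map_add, map_zsmul, map_zsmul]
  simp

lemma pt_inj {m n m' n' : ℤ} (h : pt m n = pt m' n') : m = m' ∧ n = n' := by
  have := Multiplicative.ofAdd.injective h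
  simpa using this

lemma lat1 (r s : ℝ) : ∃ B : ℝ, {p : A2 | ∃ m n : ℤ, p = pt m n ∧ |m * r + n * s| ≤ B}.Infinite := by
  by_cases hs : s = 0
  · refine ⟨0, Set.infinite_of_injective_forall_mem (f := fun n : ℤ => pt 0 n) ?_ ?_⟩
    · intro a b h; exact (pt_inj h).2
    · intro n; exact ⟨0, n, rfl, by simp [hs]⟩
  · refine ⟨|s|, Set.infinite_of_injective_forall_mem (f := fun m : ℤ => pt m (round (-m * r / s))) ?_ ?_⟩
    · intro a b h; exact (pt_inj h).1
    · intro m; refine ⟨m, _, rfl, ?_⟩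
      have h1 := abs_sub_round (-m * r / s)
      have : m * r + (round (-m * r / s) : ℝ) * s = -(-m * r / s - round (-m * r / s)) * s := by
        field_simp; ring
      rw [this, abs_mul, abs_neg]
      have := abs_nonneg s
      nlinarith

lemma lat_bdd (x : A2 → ℝ) (hx : ∀ a b, x (a * b) = x a + x b) :
    ∃ B : ℝ, {p : A2 | |x p| ≤ B}.Infinite := by
  obtain ⟨r, s, h⟩ := add_form x hx
  obtain ⟨B, hB⟩ := lat1 r s
  refine ⟨B, hB.mono ?_⟩
  rintro p ⟨m, n, rfl, h1⟩
  simpa [h] using h1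

lemma lat2 (x y : A2 → ℝ) (hx : ∀ a b, x (a * b) = x a + x b) (hy : ∀ a b, y (a * b) = y a + y b) :
    (∃ B : ℝ, {p : A2 | |x p| ≤ B ∧ |y p| ≤ B}.Infinite) ∨
    ∃ C : ℝ, 0 ≤ C ∧ ∀ X Y : ℝ, ∃ p, |x p - X| ≤ C ∧ |y p - Y| ≤ C := by
  obtain ⟨r, s, h⟩ := add_form x hx
  obtain ⟨r', s', h'⟩ := add_form y hy
  by_cases hD : r * s' - s * r' = 0
  · left
    obtain ⟨z1, z2, c, d, e1, e2, e3, e4⟩ : ∃ z1 z2 c d : ℝ, r = c * z1 ∧ s = c * z2 ∧ r' = d * z1 ∧ s' = d * z2 := by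
      by_cases hr : r = 0
      · by_cases hs : s = 0
        · exact ⟨r', s', 0, 1, by simp [hr], by simp [hs], by simp, by simp⟩
        · exact ⟨r, s, 1, s' / s, by simp, by simp, by field_simp; linarith, by field_simp⟩
      · exact ⟨r, s, 1, r' / r, by simp, by simp, by field_simp, by field_simp; linarith⟩
    obtain ⟨B, hB⟩ := lat1 z1 z2
    refine ⟨max (|c| * B) (|d| * B), hB.mono ?_⟩
    rintro p ⟨m, n, rfl, h1⟩
    constructor
    · refine le_trans ?_ (le_max_left _ _)
      rw [h, e1, e2, show m * (c * z1) + n * (c * z2) = c * (m * z1 + n * z2) by ring, abs_mul]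
      gcongr
    · refine le_trans ?_ (le_max_right _ _)
      rw [h', e3, e4, show m * (d * z1) + n * (d * z2) = d * (m * z1 + n * z2) by ring, abs_mul]
      gcongr
  · right
    refine ⟨|r| + |s| + |r'| + |s'|, by positivity, fun X Y => ?_⟩
    set D := r * s' - s * r' with hDd
    set a := (X * s' - s * Y) / D with ha
    set b := (r * Y - X * r') / D with hb
    have hX : X = a * r + b * s := by rw [ha, hb]; field_simp; rw [hDd]; ring
    have hY : Y = a * r' + b * s' := by rw [ha, hb]; field_simp; rw [hDd]; ring
    have ka := abs_sub_round a
    have kb := abs_sub_round b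
    have key : ∀ u v : ℝ, |(round a * u + round b * v) - (a * u + b * v)| ≤ |u| + |v| := by
      intro u v
      rw [show (round a * u + round b * v) - (a * u + b * v) = -((a - round a) * u) + -((b - round b) * v) by ring]
      refine (abs_add_le _ _).trans ?_
      rw [abs_neg, abs_neg, abs_mul, abs_mul]
      have := abs_nonneg u
      have := abs_nonneg v
      nlinarith
    refine ⟨pt (round a) (round b), ?_, ?_⟩
    · rw [h, hX]; have := key r s; have := abs_nonneg r'; have := abs_nonneg s'; linarith
    · rw [h', hY]; have := key r' s'; have := abs_nonneg r; have := abs_nonneg s; linarith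

/-- Data of a coarse pair of additive functions contradicts regularity. -/
lemma nonreg (M : A2 →* Mat) (h : RegH M) (x y : A2 → ℝ)
    (hx : ∀ a b, x (a * b) = x a + x b) (hy : ∀ a b, y (a * b) = y a + y b)
    (hb : ∀ B : ℝ, 0 ≤ B → ∃ K, ∀ p, |x p| ≤ B → |y p| ≤ B → ‖M p‖ ≤ K)
    (hc : ∀ C : ℝ, 0 ≤ C → ∃ K : ℝ, ∃ X Y : ℝ → ℝ, ∀ N : ℝ, ∃ R : ℝ, ∀ p, |x p - X R| ≤ C →
      |y p - Y R| ≤ C → ‖M p‖ ^ 2 ≤ K * ‖M p⁻¹‖ ∧ N < ‖M p⁻¹‖) : False := by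
  rcases lat2 x y hx hy with ⟨B, hB⟩ | ⟨C, hC, hp⟩
  · obtain ⟨p0, hp0⟩ := hB.nonempty
    have hB0 : 0 ≤ B := (abs_nonneg _).trans hp0.1
    obtain ⟨K, hK⟩ := hb B hB0
    exact hB ((h.bdd K).subset fun p hp => hK p hp.1 hp.2)
  · obtain ⟨K, X, Y, hN⟩ := hc C hC
    obtain ⟨N, hN'⟩ := h.bdd_inv K
    obtain ⟨R, hR⟩ := hN N
    obtain ⟨p, h1, h2⟩ := hp (X R) (Y R)
    obtain ⟨h3, h4⟩ := hR p h1 h2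
    exact absurd (hN' p h3) (not_le.2 h4)

lemma inv_mul_rho (M : A2 →* Mat) (p : A2) : M p * M p⁻¹ = 1 := by rw [← map_mul]; simp

/-- diagonal case -/
lemma caseD (M : A2 →* Mat) (h : RegH M) (hdet : ∀ p, (M p).det = 1)
    (hd : ∀ p i j, i ≠ j → M p i j = 0) : False := by
  have hm : ∀ p q i, M (p * q) i i = M p i i * M q i i := by
    intro p q i
    rw [map_mul, Matrix.mul_apply, Finset.sum_eq_single i]
    · intro j _ hj; rw [hd p i j hj.symm, zero_mul]
    · simp
  have hdet' : ∀ p, M p 0 0 * M p 1 1 * M p 2 2 = 1 := by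
    intro p
    have := hdet p
    rw [Matrix.det_fin_three] at this
    simpa [hd p 0 1 (by decide), hd p 0 2 (by decide), hd p 1 2 (by decide),
      hd p 1 0 (by decide), hd p 2 0 (by decide), hd p 2 1 (by decide)] using this
  have h0 : ∀ p, M p 0 0 ≠ 0 := fun p e => by have := hdet' p; simp [e] at this
  have h1 : ∀ p, M p 1 1 ≠ 0 := fun p e => by have := hdet' p; simp [e] at this
  have h2 : ∀ p, M p 2 2 ≠ 0 := fun p e => by have := hdet' p; simp [e] at this
  have a0 : ∀ p, |M p 0 0| = Real.exp (Real.log |M p 0 0|) := fun p =>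
    (Real.exp_log (abs_pos.2 (h0 p))).symm
  have a1 : ∀ p, |M p 1 1| = Real.exp (Real.log |M p 1 1|) := fun p =>
    (Real.exp_log (abs_pos.2 (h1 p))).symm
  have a2 : ∀ p, |M p 2 2| = Real.exp (-(Real.log |M p 0 0| + Real.log |M p 1 1|)) := fun p => by
    rw [Real.exp_neg, Real.exp_add, ← a0, ← a1]
    have := hdet' p
    have h3 : |M p 0 0| * |M p 1 1| * |M p 2 2| = 1 := by rw [← abs_mul, ← abs_mul, this, abs_one]
    have := abs_pos.2 (h0 p)
    have := abs_pos.2 (h1 p)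
    field_simp
    linarith
  have i2 : ∀ p, |M p⁻¹ 2 2| = Real.exp (Real.log |M p 0 0| + Real.log |M p 1 1|) := fun p => by
    have h4 : M p 2 2 * M p⁻¹ 2 2 = 1 := by rw [← hm]; simp
    have h5 : |M p 2 2| * |M p⁻¹ 2 2| = 1 := by rw [← abs_mul, h4, abs_one]
    rw [a2, Real.exp_neg] at h5
    have := Real.exp_pos (Real.log |M p 0 0| + Real.log |M p 1 1|)
    field_simp at h5
    exact h5
  have bd : ∀ p K, |M p 0 0| ≤ K → |M p 1 1| ≤ K → |M p 2 2| ≤ K → ‖M p‖ ≤ 3 * K := by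
    intro p K k0 k1 k2
    apply le_entry
    intro i j
    by_cases hij : i = j
    · subst hij; fin_cases i <;> assumption
    · rw [hd p i j hij, abs_zero]; exact (abs_nonneg _).trans k0
  refine nonreg M h (fun p => Real.log |M p 0 0|) (fun p => Real.log |M p 1 1|) ?_ ?_ ?_ ?_
  · intro a b; simp only [hm, abs_mul]; exact Real.log_mul (abs_ne_zero.2 (h0 a)) (abs_ne_zero.2 (h0 b))
  · intro a b; simp only [hm, abs_mul]; exact Real.log_mul (abs_ne_zero.2 (h1 a)) (abs_ne_zero.2 (h1 b))
  · intro B hB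
    refine ⟨3 * Real.exp (2 * B), fun p k0 k1 => bd p _ ?_ ?_ ?_⟩
    · rw [a0]; apply Real.exp_le_exp.2; linarith [(abs_le.1 k0).2]
    · rw [a1]; apply Real.exp_le_exp.2; linarith [(abs_le.1 k1).2]
    · rw [a2]; apply Real.exp_le_exp.2; linarith [(abs_le.1 k0).1, (abs_le.1 k1).1]
  · intro C hC
    refine ⟨9 * Real.exp (6 * C), id, id, fun N => ⟨|N| + C, fun p k0 k1 => ?_⟩⟩
    simp only [id] at k0 k1
    set R := |N| + C
    have hR : 0 ≤ R := by positivity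
    have e0 := abs_le.1 k0
    have e1 := abs_le.1 k1
    have b1 : ‖M p‖ ≤ 3 * Real.exp (R + 2 * C) := by
      apply bd
      · rw [a0]; apply Real.exp_le_exp.2; linarith
      · rw [a1]; apply Real.exp_le_exp.2; linarith
      · rw [a2]; apply Real.exp_le_exp.2; linarith
    have b2 : Real.exp (2 * R - 2 * C) ≤ ‖M p⁻¹‖ := by
      refine le_trans ?_ (entry_le _ 2 2)
      rw [i2]; apply Real.exp_le_exp.2; linarith
    constructor
    · calc ‖M p‖ ^ 2 ≤ (3 * Real.exp (R + 2 * C)) ^ 2 := by gcongr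
        _ = 9 * Real.exp (6 * C) * Real.exp (2 * R - 2 * C) := by
          rw [mul_pow, ← Real.exp_nat_mul, mul_assoc, ← Real.exp_add]; norm_num; ring_nf
        _ ≤ _ := by gcongr
    · refine lt_of_lt_of_le ?_ b2
      have := Real.add_one_le_exp (2 * R - 2 * C)
      have h3 := le_abs_self N
      have : R = |N| + C := rfl
      have := abs_nonneg N
      linarith

/-- block case -/
lemma caseB (M : A2 →* Mat) (h : RegH M) (hdet : ∀ p, (M p).det = 1)
    (hd : ∀ p, M p 0 1 = 0 ∧ M p 0 2 = 0 ∧ M p 1 0 = 0 ∧ M p 2 0 = 0 ∧ M p 2 1 = 0 ∧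
      M p 2 2 = M p 1 1) : False := by
  choose z01 z02 z10 z20 z21 z22 using hd
  have hm1 : ∀ p q, M (p * q) 1 1 = M p 1 1 * M q 1 1 := by
    intro p q
    rw [map_mul, Matrix.mul_apply, Fin.sum_univ_three]
    simp [z10, z21]
  have hm2 : ∀ p q, M (p * q) 1 2 = M p 1 1 * M q 1 2 + M p 1 2 * M q 1 1 := by
    intro p q
    rw [map_mul, Matrix.mul_apply, Fin.sum_univ_three]
    simp [z10, z22]
  have hdet' : ∀ p, M p 0 0 * M p 1 1 * M p 1 1 = 1 := by
    intro p
    have := hdet p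
    rw [Matrix.det_fin_three] at this
    simpa [z01, z02, z10, z20, z21, z22] using this
  have h1 : ∀ p, M p 1 1 ≠ 0 := fun p e => by have := hdet' p; simp [e] at this
  have a1 : ∀ p, |M p 1 1| = Real.exp (Real.log |M p 1 1|) := fun p =>
    (Real.exp_log (abs_pos.2 (h1 p))).symm
  have a0 : ∀ p, |M p 0 0| = Real.exp (-(Real.log |M p 1 1| + Real.log |M p 1 1|)) := fun p => by
    rw [Real.exp_neg, Real.exp_add, ← a1]
    have := hdet' p
    have h3 : |M p 0 0| * |M p 1 1| * |M p 1 1| = 1 := by rw [← abs_mul, ← abs_mul, this, abs_one]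
    have := abs_pos.2 (h1 p)
    field_simp
    linarith
  have am : ∀ p, |M p 1 2| = Real.exp (Real.log |M p 1 1|) * |M p 1 2 / M p 1 1| := fun p => by
    rw [← a1, ← abs_mul, mul_div_cancel₀ _ (h1 p)]
  have i2 : ∀ p, |M p⁻¹ 1 2| = Real.exp (-Real.log |M p 1 1|) * |M p 1 2 / M p 1 1| := fun p => by
    have h4 : M p 1 1 * M p⁻¹ 1 1 = 1 := by rw [← hm1]; simp
    have h5 : M p 1 1 * M p⁻¹ 1 2 + M p 1 2 * M p⁻¹ 1 1 = 0 := by rw [← hm2]; simp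
    rw [Real.exp_neg, ← a1, ← abs_inv, ← abs_mul, ← abs_neg]
    congr 1
    have := h1 p
    have h6 : M p⁻¹ 1 1 = (M p 1 1)⁻¹ := by field_simp; linarith
    rw [h6] at h5
    field_simp at h5 ⊢
    linarith
  have bd : ∀ p K, |M p 0 0| ≤ K → |M p 1 1| ≤ K → |M p 1 2| ≤ K → ‖M p‖ ≤ 3 * K := by
    intro p K k0 k1 k2
    have hK := (abs_nonneg _).trans k0
    apply le_entry
    intro i j
    fin_cases i <;> fin_cases j <;> simp [z01, z02, z10, z20, z21, z22, hK] <;> assumption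
  refine nonreg M h (fun p => Real.log |M p 1 1|) (fun p => M p 1 2 / M p 1 1) ?_ ?_ ?_ ?_
  · intro a b; simp only [hm1, abs_mul]; exact Real.log_mul (abs_ne_zero.2 (h1 a)) (abs_ne_zero.2 (h1 b))
  · intro a b; simp only [hm1, hm2]
    have := h1 a
    have := h1 b
    field_simp
    ring
  · intro B hB
    refine ⟨3 * (Real.exp (2 * B) * (1 + B)), fun p k0 k1 => bd p _ ?_ ?_ ?_⟩
    · rw [a0]
      refine le_trans (Real.exp_le_exp.2 ?_) (le_mul_of_one_le_right (Real.exp_pos _).le (by linarith))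
      linarith [(abs_le.1 k0).1]
    · rw [a1]
      refine le_trans (Real.exp_le_exp.2 ?_) (le_mul_of_one_le_right (Real.exp_pos _).le (by linarith))
      linarith [(abs_le.1 k0).2]
    · rw [am]
      refine mul_le_mul (Real.exp_le_exp.2 ?_) (by linarith) (abs_nonneg _) (Real.exp_pos _).le
      linarith [(abs_le.1 k0).2]
  · intro C hC
    refine ⟨18 * (1 + C) ^ 2 * Real.exp (5 * C), fun R => -R, fun R => Real.exp (3 * R),
      fun N => ⟨2 * |N| + 2 * C, fun p k0 k1 => ?_⟩⟩
    set R := 2 * |N| + 2 * C with hRd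
    have hN0 := abs_nonneg N
    have hR : 0 ≤ R := by positivity
    have e0 := abs_le.1 k0
    have e1 := abs_le.1 k1
    have hC3 : 2 * C ≤ Real.exp (3 * R) := by
      have := Real.add_one_le_exp (3 * R)
      linarith
    have hn : |M p 1 2 / M p 1 1| ≤ Real.exp (3 * R) * (1 + C) := by
      have : 1 ≤ Real.exp (3 * R) := Real.one_le_exp (by linarith)
      rw [abs_le]; constructor <;> nlinarith
    have hn' : Real.exp (3 * R) / 2 ≤ |M p 1 2 / M p 1 1| := by
      refine le_trans ?_ (le_abs_self _); linarith
    have b1 : ‖M p‖ ≤ 3 * (Real.exp (2 * R + 2 * C) * (1 + C)) := by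
      apply bd
      · rw [a0]
        refine le_trans (Real.exp_le_exp.2 ?_) (le_mul_of_one_le_right (Real.exp_pos _).le (by linarith))
        linarith
      · rw [a1]
        refine le_trans (Real.exp_le_exp.2 ?_) (le_mul_of_one_le_right (Real.exp_pos _).le (by linarith))
        linarith
      · rw [am]
        calc _ ≤ Real.exp (-R + 2 * C) * (Real.exp (3 * R) * (1 + C)) := by
              refine mul_le_mul (Real.exp_le_exp.2 ?_) hn (abs_nonneg _) (Real.exp_pos _).le
              linarith
          _ = _ := by rw [← mul_assoc, ← Real.exp_add]; ring_nf
    have b2 : Real.exp (4 * R - C) / 2 ≤ ‖M p⁻¹‖ := by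
      refine le_trans ?_ (entry_le _ 1 2)
      rw [i2]
      calc _ = Real.exp (R - C) * (Real.exp (3 * R) / 2) := by
            rw [← mul_div_assoc, ← Real.exp_add]; ring_nf
        _ ≤ _ := by
            refine mul_le_mul (Real.exp_le_exp.2 ?_) hn' (by positivity) (Real.exp_pos _).le
            linarith
    constructor
    · calc ‖M p‖ ^ 2 ≤ (3 * (Real.exp (2 * R + 2 * C) * (1 + C))) ^ 2 := by gcongr
        _ = 18 * (1 + C) ^ 2 * Real.exp (5 * C) * (Real.exp (4 * R - C) / 2) := by
          rw [mul_pow, mul_pow, ← Real.exp_nat_mul,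
            show ((2:ℕ):ℝ) * (2 * R + 2 * C) = 5 * C + (4 * R - C) by push_cast; ring, Real.exp_add]; ring
        _ ≤ _ := by gcongr
    · refine lt_of_lt_of_le ?_ b2
      have := Real.add_one_le_exp (4 * R - C)
      have h3 := le_abs_self N
      linarith

/-- full unipotent case -/
lemma caseU (M : A2 →* Mat) (h : RegH M) (c : ℝ) (hc : c ≠ 0)
    (hd : ∀ p, M p 0 0 = 1 ∧ M p 1 1 = 1 ∧ M p 2 2 = 1 ∧ M p 1 0 = 0 ∧ M p 2 0 = 0 ∧ M p 2 1 = 0 ∧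
      M p 1 2 = c * M p 0 1) : False := by
  choose d0 d1 d2 z10 z20 z21 hb using hd
  have hm1 : ∀ p q, M (p * q) 0 1 = M p 0 1 + M q 0 1 := by
    intro p q
    rw [map_mul, Matrix.mul_apply, Fin.sum_univ_three]
    simp [d0, d1, z21, add_comm]
  have hm2 : ∀ p q, M (p * q) 0 2 = M p 0 2 + M q 0 2 + c * M p 0 1 * M q 0 1 := by
    intro p q
    rw [map_mul, Matrix.mul_apply, Fin.sum_univ_three]
    simp [d0, d2, hb]; ring
  have i2 : ∀ p, M p⁻¹ 0 2 = c * (M p 0 1) ^ 2 - M p 0 2 := fun p => by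
    have h4 : M p 0 1 + M p⁻¹ 0 1 = 0 := by rw [← hm1]; simp
    have h5 : M p 0 2 + M p⁻¹ 0 2 + c * M p 0 1 * M p⁻¹ 0 1 = 0 := by rw [← hm2]; simp
    have : M p⁻¹ 0 1 = - M p 0 1 := by linarith
    rw [this] at h5; linarith
  have bd : ∀ p K, 1 ≤ K → |M p 0 1| ≤ K → |c * M p 0 1| ≤ K → |M p 0 2| ≤ K → ‖M p‖ ≤ 3 * K := by
    intro p K k0 k1 k2 k3
    have hK : 0 ≤ K := by linarith
    apply le_entry
    intro i j
    fin_cases i <;> fin_cases j <;> simp [d0, d1, d2, z10, z20, z21, hb] <;>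
      first | assumption | (rw [← abs_mul]; assumption)
  have hc0 : 0 < |c| := abs_pos.2 hc
  refine nonreg M h (fun p => M p 0 1) (fun p => M p 0 2 - c / 2 * (M p 0 1) ^ 2) hm1 ?_ ?_ ?_
  · intro a b; simp only [hm1, hm2]; ring
  · intro B hB
    refine ⟨3 * (1 + B + |c| * B + (B + |c| * B ^ 2)), fun p k0 k1 => ?_⟩
    apply bd
    · have : 0 ≤ B + |c| * B + (B + |c| * B ^ 2) := by positivity
      linarith
    · have : 0 ≤ |c| * B + (B + |c| * B ^ 2) := by positivity
      linarith
    · have h1 : |c * M p 0 1| ≤ |c| * B := by rw [abs_mul]; gcongr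
      have : 0 ≤ (B + |c| * B ^ 2) := by positivity
      linarith
    · have h1 : |c / 2 * (M p 0 1) ^ 2| ≤ |c| * B ^ 2 := by
        rw [abs_mul, abs_div, abs_pow, abs_two]; gcongr; linarith
      have h2 := abs_add_le (M p 0 2 - c / 2 * (M p 0 1) ^ 2) (c / 2 * (M p 0 1) ^ 2)
      rw [sub_add_cancel] at h2
      have : 0 ≤ |c| * B := by positivity
      linarith
  · intro C hC
    set K := 1 + C + |c| * (1 + C) + (C + |c| * (C * (2 + C))) with hK
    refine ⟨9 * K ^ 2 * (4 / |c|), fun R => R, fun R => - c / 2 * R ^ 2,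
      fun N => ⟨1 + 4 * C / |c| + 4 * |N| / |c|, fun p k0 k1 => ?_⟩⟩
    set R := 1 + 4 * C / |c| + 4 * |N| / |c| with hR
    have hN0 := abs_nonneg N
    have q1 : 0 ≤ 4 * C / |c| := by positivity
    have q2 : 0 ≤ 4 * |N| / |c| := by positivity
    have hR1 : 1 ≤ R := by linarith
    have e0 := abs_le.1 k0
    have e1 := abs_le.1 k1
    simp only at e0 e1
    have hcR : |c| * R = |c| + 4 * C + 4 * |N| := by rw [hR]; field_simp
    have ha : |M p 0 1| ≤ (1 + C) * R := by
      rw [abs_le]; constructor <;> nlinarith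
    have b1 : ‖M p‖ ≤ 3 * (K * R) := by
      have p1 : 0 ≤ |c| * (1 + C) := by positivity
      have p2 : 0 ≤ |c| * (C * (2 + C)) := by positivity
      have hCR : C ≤ C * R := by nlinarith
      apply bd
      · nlinarith
      · refine ha.trans ?_
        gcongr; linarith
      · rw [abs_mul]
        calc |c| * |M p 0 1| ≤ |c| * ((1 + C) * R) := by gcongr
          _ = |c| * (1 + C) * R := by ring
          _ ≤ K * R := by gcongr; linarith
      · have hu : M p 0 2 = (M p 0 2 - c / 2 * (M p 0 1) ^ 2 - -c / 2 * R ^ 2) +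
            (c / 2) * ((M p 0 1 - R) * (M p 0 1 + R)) := by ring
        have h5 : |M p 0 1 + R| ≤ (2 + C) * R := by
          rw [abs_le]; constructor <;> nlinarith
        have h6 : |(c / 2) * ((M p 0 1 - R) * (M p 0 1 + R))| ≤ |c| * (C * ((2 + C) * R)) := by
          rw [abs_mul, abs_mul, abs_div, abs_two]
          gcongr
          linarith
        rw [hu]
        refine (abs_add_le _ _).trans ?_
        calc _ ≤ C + |c| * (C * ((2 + C) * R)) := add_le_add k1 h6
          _ ≤ C * R + |c| * (C * ((2 + C) * R)) := by linarith
          _ = (C + |c| * (C * (2 + C))) * R := by ring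
          _ ≤ K * R := by gcongr; linarith
    have b2 : |c| / 4 * R ^ 2 ≤ ‖M p⁻¹‖ := by
      refine le_trans ?_ (entry_le _ 0 2)
      rw [i2, show c * (M p 0 1) ^ 2 - M p 0 2 = c * ((M p 0 1) ^ 2 / 2 + R ^ 2 / 2) - (M p 0 2 - c / 2 * (M p 0 1) ^ 2 - -c / 2 * R ^ 2) by ring]
      refine le_trans ?_ (abs_sub_abs_le_abs_sub _ _)
      rw [abs_mul, abs_of_nonneg (a := (M p 0 1) ^ 2 / 2 + R ^ 2 / 2) (by positivity)]
      have : C ≤ |c| / 4 * R ^ 2 := by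
        rw [show |c| / 4 * R ^ 2 = (|c| * R) / 4 * R by ring, hcR]
        have : (|c| + 4 * C + 4 * |N|) / 4 * 1 ≤ (|c| + 4 * C + 4 * |N|) / 4 * R := by gcongr
        linarith
      have h7 : 0 ≤ |c| * (M p 0 1) ^ 2 := by positivity
      rw [mul_add]
      linarith
    constructor
    · calc ‖M p‖ ^ 2 ≤ (3 * (K * R)) ^ 2 := by gcongr
        _ = 9 * K ^ 2 * (4 / |c|) * (|c| / 4 * R ^ 2) := by field_simp; ring
        _ ≤ _ := by gcongr
    · refine lt_of_lt_of_le ?_ b2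
      have h3 := le_abs_self N
      rw [show |c| / 4 * R ^ 2 = (|c| * R) / 4 * R by ring, hcR]
      have : (|c| + 4 * C + 4 * |N|) / 4 * 1 ≤ (|c| + 4 * C + 4 * |N|) / 4 * R := by gcongr
      linarith

open Matrix in
lemma conj_comm (M : A2 →* Mat) (S T : Mat) (hS : S * T = 1) (P E : Mat) (hE : P * S = S * E)
    (hP : ∀ p, P * M p = M p * P) (p : A2) : E * conj M S T hS p = conj M S T hS p * E := by
  change E * (T * M p * S) = T * M p * S * E
  have hT : T * S = 1 := mul_eq_one_comm.1 hS
  have hE' : E * T = T * P := by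
    calc E * T = (T * S) * E * T := by rw [hT, one_mul]
      _ = T * (P * S) * T := by rw [hE]; simp only [mul_assoc]
      _ = T * P * (S * T) := by simp only [mul_assoc]
      _ = _ := by rw [hS, mul_one]
  calc E * (T * M p * S) = (E * T) * M p * S := by simp only [mul_assoc]
    _ = T * (P * M p) * S := by rw [hE']; simp only [mul_assoc]
    _ = T * M p * (P * S) := by rw [hP]; simp only [mul_assoc]
    _ = _ := by rw [hE]; simp only [mul_assoc]

lemma conj_det (M : A2 →* Mat) (hdet : ∀ p, (M p).det = 1) (S T : Mat) (hS : S * T = 1) (p : A2) :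
    (conj M S T hS p).det = 1 := by
  change (T * M p * S).det = 1
  rw [Matrix.det_mul, Matrix.det_mul, hdet, mul_one, ← Matrix.det_mul, mul_eq_one_comm.1 hS,
    Matrix.det_one]

lemma inv_of_det (S : Mat) (h : S.det ≠ 0) : S * S⁻¹ = 1 :=
  Matrix.mul_nonsing_inv _ (isUnit_iff_ne_zero.2 h)

abbrev dot (f v : Fin 3 → ℝ) : ℝ := f 0 * v 0 + f 1 * v 1 + f 2 * v 2

def cols (a b c : Fin 3 → ℝ) : Mat := fun i j => ![a i, b i, c i] j

lemma cols_det (a b c : Fin 3 → ℝ) : (cols a b c).det =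
    a 0 * (b 1 * c 2 - b 2 * c 1) - b 0 * (a 1 * c 2 - a 2 * c 1) + c 0 * (a 1 * b 2 - a 2 * b 1) := by
  rw [Matrix.det_fin_three]; simp [cols]; ring

lemma dot_self_pos (v : Fin 3 → ℝ) (h : v ≠ 0) : 0 < dot v v := by
  by_contra hc
  apply h
  have e : v 0 * v 0 + v 1 * v 1 + v 2 * v 2 ≤ 0 := not_lt.1 hc
  have h0 := mul_self_nonneg (v 0)
  have h1 := mul_self_nonneg (v 1)
  have h2 := mul_self_nonneg (v 2)
  have g0 : v 0 = 0 := mul_self_eq_zero.1 (by linarith)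
  have g1 : v 1 = 0 := mul_self_eq_zero.1 (by linarith)
  have g2 : v 2 = 0 := mul_self_eq_zero.1 (by linarith)
  ext i
  fin_cases i
  · exact g0
  · exact g1
  · exact g2

/-- `vecMulVec v f` acting on columns. -/
lemma vmv_cols (v f a b c : Fin 3 → ℝ) :
    Matrix.vecMulVec v f * cols a b c = fun i j => v i * ![dot f a, dot f b, dot f c] j := by
  ext i j
  rw [Matrix.mul_apply, Fin.sum_univ_three]
  simp only [Matrix.vecMulVec_apply, cols, dot]
  fin_cases j <;> simp <;> ring

lemma caseD2 (M : A2 →* Mat) (h : RegH M) (hdet : ∀ p, (M p).det = 1) (v f w k : Fin 3 → ℝ)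
    (hP : ∀ p, Matrix.vecMulVec v f * M p = M p * Matrix.vecMulVec v f)
    (hQ : ∀ p, Matrix.vecMulVec w k * M p = M p * Matrix.vecMulVec w k)
    (fv : dot f v ≠ 0) (kw : dot k w ≠ 0) (fw : dot f w = 0) (kv : dot k v = 0) : False := by
  let z : Fin 3 → ℝ := ![f 1 * k 2 - f 2 * k 1, f 2 * k 0 - f 0 * k 2, f 0 * k 1 - f 1 * k 0]
  have fz : dot f z = 0 := by simp [dot, z]; ring
  have kz : dot k z = 0 := by simp [dot, z]; ring
  have hS : (cols v w z).det ≠ 0 := by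
    have : (cols v w z).det = dot f v * dot k w - dot f w * dot k v := by
      rw [cols_det]; simp [dot, z]; ring
    rw [this, fw, zero_mul, sub_zero]
    exact mul_ne_zero fv kw
  have hST := inv_of_det _ hS
  set S := cols v w z with hSd
  have c1 := conj_comm M S _ hST (Matrix.vecMulVec v f) !![dot f v, 0, 0; 0, 0, 0; 0, 0, 0] (by
    rw [hSd, vmv_cols, fw, fz]
    ext i j
    rw [Matrix.mul_apply, Fin.sum_univ_three]
    fin_cases j <;> simp [cols]) hP
  have c2 := conj_comm M S _ hST (Matrix.vecMulVec w k) !![0, 0, 0; 0, dot k w, 0; 0, 0, 0] (by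
    rw [hSd, vmv_cols, kv, kz]
    ext i j
    rw [Matrix.mul_apply, Fin.sum_univ_three]
    fin_cases j <;> simp [cols]) hQ
  refine caseD (conj M S _ hST) (h.conj S _ hST) (conj_det M hdet S _ hST) ?_
  intro p i j hij
  have t1 := fun i j => congrFun (congrFun (c1 p) i) j
  have t2 := fun i j => congrFun (congrFun (c2 p) i) j
  simp only [Matrix.mul_apply, Fin.sum_univ_three] at t1 t2
  have t11 := t1 0 1
  have t12 := t1 0 2
  have t13 := t1 1 0
  have t14 := t1 2 0
  have t21 := t2 1 2
  have t22 := t2 2 1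
  simp [-mul_eq_zero] at t11 t12 t13 t14 t21 t22
  have fv' := fv
  have kw' := kw
  simp only [dot] at fv' kw'
  fin_cases i <;> fin_cases j <;> simp_all

lemma caseB2 (M : A2 →* Mat) (h : RegH M) (hdet : ∀ p, (M p).det = 1) (v f w k : Fin 3 → ℝ)
    (hP : ∀ p, Matrix.vecMulVec v f * M p = M p * Matrix.vecMulVec v f)
    (hQ : ∀ p, Matrix.vecMulVec w k * M p = M p * Matrix.vecMulVec w k) (hw : w ≠ 0) (hk : k ≠ 0)
    (fv : dot f v ≠ 0) (kw : dot k w = 0) (fw : dot f w = 0) (kv : dot k v = 0) : False := by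
  let z : Fin 3 → ℝ := fun i => dot f v * k i - dot f k * v i
  have fz : dot f z = 0 := by simp only [dot, z]; ring
  have kz : dot k z ≠ 0 := by
    have : dot k z = dot f v * dot k k - dot f k * dot k v := by simp only [dot, z]; ring
    rw [this, kv, mul_zero, sub_zero]
    exact mul_ne_zero fv (dot_self_pos k hk).ne'
  have hS : (cols v w z).det ≠ 0 := by
    have : (cols f w k).det * (cols v w z).det = dot f v * (dot w w * dot k z - dot w z * dot k w)
       - dot f w * (dot w v * dot k z - dot w z * dot k v) + dot f z * (dot w v * dot k w - dot w w * dot k v) := by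
      rw [cols_det, cols_det]; simp only [dot]; ring
    intro h0
    rw [h0, fw, fz, kw] at this
    simp only [mul_zero, zero_mul, sub_zero, add_zero] at this
    exact mul_ne_zero fv (mul_ne_zero (dot_self_pos w hw).ne' kz) this.symm
  have hST := inv_of_det _ hS
  set S := cols v w z with hSd
  have c1 := conj_comm M S _ hST (Matrix.vecMulVec v f) !![dot f v, 0, 0; 0, 0, 0; 0, 0, 0] (by
    rw [hSd, vmv_cols, fw, fz]
    ext i j
    rw [Matrix.mul_apply, Fin.sum_univ_three]
    fin_cases j <;> simp [cols]) hP
  have c2 := conj_comm M S _ hST (Matrix.vecMulVec w k) !![0, 0, 0; 0, 0, dot k z; 0, 0, 0] (by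
    rw [hSd, vmv_cols, kv, kw]
    ext i j
    rw [Matrix.mul_apply, Fin.sum_univ_three]
    fin_cases j <;> simp [cols]) hQ
  refine caseB (conj M S _ hST) (h.conj S _ hST) (conj_det M hdet S _ hST) ?_
  intro p
  have t1 := fun i j => congrFun (congrFun (c1 p) i) j
  have t2 := fun i j => congrFun (congrFun (c2 p) i) j
  simp only [Matrix.mul_apply, Fin.sum_univ_three] at t1 t2
  have t11 := t1 0 1
  have t12 := t1 0 2
  have t13 := t1 1 0
  have t14 := t1 2 0
  have t21 := t2 1 1
  have t22 := t2 1 2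
  generalize dot f v = d at *
  generalize dot k z = e at *
  simp [-mul_eq_zero] at t11 t12 t13 t14 t21 t22
  refine ⟨?_, ?_, ?_, ?_, ?_, ?_⟩
  · simpa [fv] using t11
  · simpa [fv] using t12
  · simpa [fv] using t13
  · simpa [fv] using t14
  · simpa [kz] using t21
  · exact mul_left_cancel₀ kz (by rw [t22]; ring)

/-- The two horospherical types. -/
def Type1 (M : A2 → Mat) : Prop :=
  ∃ f : Fin 3 → ℝ, ∃ v : A2 → Fin 3 → ℝ, ∀ p, M p = 1 + Matrix.vecMulVec (v p) f ∧ f ⬝ᵥ v p = 0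

def Type2 (M : A2 → Mat) : Prop :=
  ∃ v : Fin 3 → ℝ, ∃ f : A2 → Fin 3 → ℝ, ∀ p, M p = 1 + Matrix.vecMulVec v (f p) ∧ f p ⬝ᵥ v = 0

lemma unconj (M : A2 →* Mat) (S T : Mat) (hS : S * T = 1) (p : A2) (v f : Fin 3 → ℝ)
    (h1 : conj M S T hS p = 1 + Matrix.vecMulVec v f) (h2 : f ⬝ᵥ v = 0) :
    M p = 1 + Matrix.vecMulVec (S.mulVec v) (Matrix.vecMul f T) ∧ Matrix.vecMul f T ⬝ᵥ S.mulVec v = 0 := by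
  have hT : T * S = 1 := mul_eq_one_comm.1 hS
  change T * M p * S = _ at h1
  constructor
  · calc M p = (S * T) * M p * (S * T) := by rw [hS]; simp
      _ = S * (T * M p * S) * T := by simp only [mul_assoc]
      _ = _ := by
        rw [h1, mul_add, add_mul, mul_one, hS, Matrix.mul_vecMulVec, Matrix.vecMulVec_mul]
  · rw [← Matrix.dotProduct_mulVec, Matrix.mulVec_mulVec, hT, Matrix.one_mulVec, h2]

lemma caseT (M : A2 →* Mat) (h : RegH M) (hdet : ∀ p, (M p).det = 1) (v f : Fin 3 → ℝ)
    (hP : ∀ p, Matrix.vecMulVec v f * M p = M p * Matrix.vecMulVec v f)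
    (hv : v ≠ 0) (hf : f ≠ 0) (fv : dot f v = 0) : Type1 M ∨ Type2 M := by
  let z : Fin 3 → ℝ := ![f 1 * v 2 - f 2 * v 1, f 2 * v 0 - f 0 * v 2, f 0 * v 1 - f 1 * v 0]
  have fz : dot f z = 0 := by simp [dot, z]; ring
  have hff := (dot_self_pos f hf).ne'
  have hS : (cols v z f).det ≠ 0 := by
    have : (cols v z f).det = (dot f f * dot v v - dot f v * dot f v) := by
      rw [cols_det]; simp [dot, z]; ring
    rw [this, fv, zero_mul, sub_zero]
    exact mul_ne_zero hff (dot_self_pos v hv).ne'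
  have hST := inv_of_det _ hS
  set S := cols v z f with hSd
  have c1 := conj_comm M S _ hST (Matrix.vecMulVec v f) !![0, 0, dot f f; 0, 0, 0; 0, 0, 0] (by
    rw [hSd, vmv_cols, fv, fz]
    ext i j
    rw [Matrix.mul_apply, Fin.sum_univ_three]
    fin_cases j <;> simp [cols]) hP
  set M' := conj M S _ hST with hM'
  have hR' : RegH M' := h.conj S _ hST
  have hdet' : ∀ p, (M' p).det = 1 := conj_det M hdet S _ hST
  have zz : ∀ p, M' p 1 0 = 0 ∧ M' p 2 0 = 0 ∧ M' p 2 1 = 0 ∧ M' p 2 2 = M' p 0 0 := by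
    intro p
    have t1 := fun i j => congrFun (congrFun (c1 p) i) j
    simp only [Matrix.mul_apply, Fin.sum_univ_three] at t1
    have t11 := t1 1 2
    have t12 := t1 2 2
    have t13 := t1 0 1
    have t14 := t1 0 2
    generalize dot f f = d at *
    simp [-mul_eq_zero] at t11 t12 t13 t14
    refine ⟨?_, ?_, ?_, ?_⟩
    · simpa [hff] using t11
    · simpa [hff] using t12
    · simpa [hff] using t13
    · exact mul_left_cancel₀ hff (by rw [t14]; ring)
  choose z10 z20 z21 z22 using zz
  have hd3 : ∀ p, M' p 0 0 * M' p 1 1 * M' p 0 0 = 1 := by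
    intro p
    have := hdet' p
    rw [Matrix.det_fin_three] at this
    simpa [z10, z20, z21, z22] using this
  have comm : ∀ p q, M' p * M' q = M' q * M' p := by
    intro p q; rw [← map_mul, ← map_mul, mul_comm]
  by_cases hne : ∃ p, M' p 1 1 ≠ M' p 0 0
  · exfalso
    obtain ⟨p, hp⟩ := hne
    set δ := M' p 1 1 - M' p 0 0 with hδ
    have hδ0 : δ ≠ 0 := sub_ne_zero.2 hp
    have hsq : Matrix.vecMulVec ![M' p 0 1, δ, 0] ![0, δ, M' p 1 2] =
        (M' p - M' p 0 0 • 1) * (M' p - M' p 0 0 • 1) := by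
      ext i j
      rw [Matrix.mul_apply, Fin.sum_univ_three]
      fin_cases i <;> fin_cases j <;> simp [Matrix.vecMulVec_apply, z10, z20, z21, z22, hδ]
    have cc : ∀ q, Commute (M' p - M' p 0 0 • 1) (M' q) := fun q =>
      Commute.sub_left (comm p q) ((Commute.one_left (M' q)).smul_left _)
    refine caseB2 M' hR' hdet' ![M' p 0 1, δ, 0] ![0, δ, M' p 1 2] ![dot f f, 0, 0] ![0, 0, 1]
      ?_ ?_ ?_ ?_ ?_ ?_ ?_ ?_
    · intro q; rw [hsq]; exact ((cc q).mul_left (cc q)).eq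
    · intro q
      have : Matrix.vecMulVec ![dot f f, 0, 0] ![0, 0, 1] = !![0, 0, dot f f; 0, 0, 0; 0, 0, 0] := by
        ext i j
        fin_cases i <;> fin_cases j <;> simp [Matrix.vecMulVec_apply]
      rw [this]; exact c1 q
    · intro h0; exact hff (by simpa using congrFun h0 0)
    · intro h0; simpa using congrFun h0 2
    · simp [dot, hδ0]
    · simp [dot]
    · simp [dot]
    · simp [dot]
  · push Not at hne
    have d0 : ∀ p, M' p 0 0 = 1 := by
      intro p
      have := hd3 p
      rw [hne] at this
      have h3 : (M' p 0 0 - 1) * (M' p 0 0 ^ 2 + M' p 0 0 + 1) = 0 := by linear_combination this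
      rcases mul_eq_zero.1 h3 with h4 | h4
      · linarith
      · nlinarith [sq_nonneg (M' p 0 0 + 1 / 2)]
    have d1 : ∀ p, M' p 1 1 = 1 := fun p => by rw [hne, d0]
    have d2 : ∀ p, M' p 2 2 = 1 := fun p => by rw [z22, d0]
    by_cases ha : ∀ p, M' p 0 1 = 0
    · left
      refine ⟨_, _, fun p => unconj M S _ hST p ![M' p 0 2, M' p 1 2, 0] ![0, 0, 1] ?_ (by simp)⟩
      change M' p = _
      ext i j
      fin_cases i <;> fin_cases j <;> simp [Matrix.vecMulVec_apply, z10, z20, z21, d0, d1, d2, ha]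
    by_cases hb : ∀ p, M' p 1 2 = 0
    · right
      refine ⟨_, _, fun p => unconj M S _ hST p ![1, 0, 0] ![0, M' p 0 1, M' p 0 2] ?_ (by simp)⟩
      change M' p = _
      ext i j
      fin_cases i <;> fin_cases j <;> simp [Matrix.vecMulVec_apply, z10, z20, z21, d0, d1, d2, hb]
    exfalso
    push Not at ha hb
    obtain ⟨p, hp⟩ := ha
    obtain ⟨q, hq⟩ := hb
    have key : ∀ p q, M' p 0 1 * M' q 1 2 = M' q 0 1 * M' p 1 2 := by
      intro p q
      have := congrFun (congrFun (comm p q) 0) 2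
      simp only [Matrix.mul_apply, Fin.sum_univ_three, d0, d2] at this
      linarith
    have hbp : M' p 1 2 ≠ 0 := by
      intro h0
      have := key p q
      rw [h0, mul_zero] at this
      exact mul_ne_zero hp hq this
    refine caseU M' hR' (M' p 1 2 / M' p 0 1) (div_ne_zero hbp hp) fun r =>
      ⟨d0 r, d1 r, d2 r, z10 r, z20 r, z21 r, ?_⟩
    have := key p r
    field_simp
    linarith

lemma rank_one (P : Mat) (h0 : P ≠ 0) (h : P.adjugate = 0) :
    ∃ v f : Fin 3 → ℝ, v ≠ 0 ∧ f ≠ 0 ∧ P = Matrix.vecMulVec v f := by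
  obtain ⟨i0, j0, hij⟩ : ∃ i j, P i j ≠ 0 := by
    by_contra hc
    push Not at hc
    exact h0 (by ext i j; exact hc i j)
  have key : ∀ i j k l, P i j * P k l = P i l * P k j := by
    rw [Matrix.adjugate_fin_three] at h
    have t := fun i j => congrFun (congrFun h i) j
    have t00 := t 0 0
    have t01 := t 0 1
    have t02 := t 0 2
    have t10 := t 1 0
    have t11 := t 1 1
    have t12 := t 1 2
    have t20 := t 2 0
    have t21 := t 2 1
    have t22 := t 2 2
    simp at t00 t01 t02 t10 t11 t12 t20 t21 t22
    intro i j k l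
    fin_cases i <;> fin_cases j <;> fin_cases k <;> fin_cases l <;> simp <;> linarith
  refine ⟨fun i => P i j0, fun j => P i0 j / P i0 j0, ?_, ?_, ?_⟩
  · intro h; exact hij (congrFun h i0)
  · intro h; have := congrFun h j0; simp [hij] at this
  · ext i j
    simp only [Matrix.vecMulVec_apply]
    field_simp
    exact key i j i0 j0

lemma adj_eq {G : Type*} [Group G] (M : G →* Mat) (hdet : ∀ p, (M p).det = 1) (p : G) :
    (M p).adjugate = M p⁻¹ := by
  have h1 : M p * (M p).adjugate = 1 := by rw [Matrix.mul_adjugate, hdet, one_smul]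
  have h2 : M p⁻¹ * M p = 1 := by rw [← map_mul]; simp
  calc (M p).adjugate = M p⁻¹ * M p * (M p).adjugate := by rw [h2, one_mul]
    _ = _ := by rw [mul_assoc, h1, mul_one]

lemma norm_pos_rho {G : Type*} [Group G] (M : G →* Mat) (p : G) : 0 < ‖M p‖ := by
  rw [norm_pos_iff]
  intro h
  have := mul_inv_rho M p
  rw [h, zero_mul] at this
  exact zero_ne_one this

lemma seq_tendsto {M : A2 →* Mat} (h : RegH M) (γ : ℕ → A2) (hγ : Function.Injective γ) :
    Tendsto (fun n => ‖M (γ n)⁻¹‖ / ‖M (γ n)‖ ^ 2) atTop (nhds 0) ∧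
    Tendsto (fun n => ‖M (γ n)‖) atTop atTop := by
  have ev : ∀ s : Set A2, s.Finite → ∀ᶠ n in atTop, γ n ∉ s := by
    intro s hs
    rw [← Nat.cofinite_eq_atTop]
    exact (hs.preimage (f := γ) hγ.injOn).compl_mem_cofinite
  constructor
  · rw [Metric.tendsto_nhds]
    intro ε hε
    filter_upwards [ev _ (h ε⁻¹)] with n hn
    have hn' : ε⁻¹ * ‖M (γ n)⁻¹‖ < ‖M (γ n)‖ ^ 2 := not_le.1 hn
    have p1 := norm_pos_rho M (γ n)
    rw [dist_zero_right, Real.norm_of_nonneg (by positivity), div_lt_iff₀ (by positivity)]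
    calc _ = ε * (ε⁻¹ * ‖M (γ n)⁻¹‖) := by field_simp
      _ < _ := by gcongr
  · rw [tendsto_atTop]
    intro B
    filter_upwards [ev _ (h.bdd B)] with n hn
    exact (not_le.1 hn).le

lemma lim_props {M : A2 →* Mat} (h : RegH M) (hdet : ∀ p, (M p).det = 1) (γ : ℕ → A2)
    (hγ : Function.Injective γ) (P : Mat)
    (hP : Tendsto (fun n => ‖M (γ n)‖⁻¹ • M (γ n)) atTop (nhds P)) :
    P ≠ 0 ∧ P.adjugate = 0 ∧ ∀ p, P * M p = M p * P := by
  obtain ⟨t1, t2⟩ := seq_tendsto h γ hγ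
  refine ⟨?_, ?_, ?_⟩
  · have h1 := hP.norm
    have h2 : (fun n => ‖‖M (γ n)‖⁻¹ • M (γ n)‖) = fun _ => (1:ℝ) := by
      funext n
      rw [norm_smul, norm_inv, norm_norm]
      exact inv_mul_cancel₀ (norm_pos_rho M _).ne'
    rw [h2] at h1
    have h3 := tendsto_nhds_unique h1 tendsto_const_nhds
    intro h0
    rw [h0, norm_zero] at h3
    exact zero_ne_one h3
  · have h1 : Tendsto (fun n => (‖M (γ n)‖⁻¹ • M (γ n)).adjugate) atTop (nhds P.adjugate) :=
      ((continuous_id.matrix_adjugate).tendsto P).comp hP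
    have h2 : Tendsto (fun n => (‖M (γ n)‖⁻¹ • M (γ n)).adjugate) atTop (nhds 0) := by
      refine tendsto_zero_iff_norm_tendsto_zero.2 ?_
      refine t1.congr ?_
      intro n
      rw [Matrix.adjugate_smul, adj_eq M hdet, norm_smul]
      simp
      field_simp
    exact tendsto_nhds_unique h1 h2
  · intro p
    have h1 := hP.mul_const (M p)
    have h2 := hP.const_mul (M p)
    refine tendsto_nhds_unique h1 (h2.congr ?_)
    intro n
    rw [mul_smul_comm, smul_mul_assoc, ← map_mul, ← map_mul, mul_comm]

lemma classify (M : A2 →* Mat) (h : RegH M) (hdet : ∀ p, (M p).det = 1) : Type1 M ∨ Type2 M := by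
  let γ : ℕ → A2 := fun n => pt n 0
  have hγ : Function.Injective γ := fun a b hab => by exact_mod_cast (pt_inj hab).1
  have hγ' : Function.Injective (fun n => (γ n)⁻¹) := fun a b hab => hγ (inv_injective hab)
  let X : ℕ → Mat × Mat := fun n => (‖M (γ n)‖⁻¹ • M (γ n), ‖M (γ n)⁻¹‖⁻¹ • M (γ n)⁻¹)
  have hn : ∀ p, ‖‖M p‖⁻¹ • M p‖ = 1 := by
    intro p
    rw [norm_smul, norm_inv, norm_norm]
    exact inv_mul_cancel₀ (norm_pos_rho M _).ne'
  have : ProperSpace Mat := FiniteDimensional.proper ℝ Mat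
  obtain ⟨⟨P, Q⟩, -, s, hs, hlim⟩ := tendsto_subseq_of_bounded (x := X)
    (Metric.isBounded_closedBall (x := (0 : Mat × Mat)) (r := 1)) (by
      intro n
      rw [mem_closedBall_zero_iff, Prod.norm_def]
      exact max_le (hn _).le (hn _).le)
  have hP : Tendsto (fun n => ‖M (γ (s n))‖⁻¹ • M (γ (s n))) atTop (nhds P) :=
    (continuous_fst.tendsto _).comp hlim
  have hQ : Tendsto (fun n => ‖M (γ (s n))⁻¹‖⁻¹ • M (γ (s n))⁻¹) atTop (nhds Q) :=
    (continuous_snd.tendsto _).comp hlim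
  have is : Function.Injective (fun n => γ (s n)) := hγ.comp hs.injective
  have is' : Function.Injective (fun n => (γ (s n))⁻¹) := hγ'.comp hs.injective
  obtain ⟨P0, Pa, Pc⟩ := lim_props h hdet _ is P hP
  obtain ⟨Q0, Qa, Qc⟩ := lim_props h hdet _ is' Q hQ
  have T1 := (seq_tendsto h _ is).2
  have T2 := (seq_tendsto h _ is').2
  have T3 : Tendsto (fun n => (‖M (γ (s n))‖⁻¹ * ‖M (γ (s n))⁻¹‖⁻¹) • (1 : Mat)) atTop (nhds 0) := by
    have := (T1.inv_tendsto_atTop.mul T2.inv_tendsto_atTop).smul_const (1 : Mat)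
    simpa using this
  have PQ : P * Q = 0 := by
    refine tendsto_nhds_unique (hP.mul hQ) (T3.congr ?_)
    intro n
    rw [smul_mul_smul_comm, mul_inv_rho]
  have QP : Q * P = 0 := by
    refine tendsto_nhds_unique (hQ.mul hP) (T3.congr ?_)
    intro n
    rw [smul_mul_smul_comm, ← map_mul, inv_mul_cancel, map_one, mul_comm]
  obtain ⟨v, f, hv, hf, rfl⟩ := rank_one P P0 Pa
  obtain ⟨w, k, hw, hk, rfl⟩ := rank_one Q Q0 Qa
  have dz : ∀ a b c d : Fin 3 → ℝ, a ≠ 0 → d ≠ 0 → Matrix.vecMulVec a b * Matrix.vecMulVec c d = 0 →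
      dot b c = 0 := by
    intro a b c d ha hd h
    obtain ⟨i, hi⟩ := Function.ne_iff.1 ha
    obtain ⟨j, hj⟩ := Function.ne_iff.1 hd
    have := congrFun (congrFun h i) j
    rw [Matrix.mul_apply, Fin.sum_univ_three] at this
    simp only [Matrix.vecMulVec_apply, Matrix.zero_apply] at this
    have h3 : a i * d j * dot b c = 0 := by simp only [dot]; linarith
    exact (mul_eq_zero.1 h3).resolve_left (mul_ne_zero hi hj)
  have fw := dz _ _ _ _ hv hk PQ
  have kv := dz _ _ _ _ hw hf QP
  by_cases fv : dot f v = 0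
  · exact caseT M h hdet v f Pc hv hf fv
  by_cases kw : dot k w = 0
  · exact caseT M h hdet w k Qc hw hk kw
  exact (caseD2 M h hdet v f w k Pc Qc fv kw fw kv).elim

section final
open Matrix
variable {G : Type*} [Group G]

lemma vmv_le (a b : Fin 3 → ℝ) : ‖vecMulVec a b‖ ≤ 3 * (‖a‖ * ‖b‖) := by
  apply le_entry
  intro i j
  rw [vecMulVec_apply, abs_mul]
  exact mul_le_mul (norm_le_pi_norm a i) (norm_le_pi_norm b j) (abs_nonneg _) (norm_nonneg _)

lemma le_vmv (a b : Fin 3 → ℝ) (j : Fin 3) : ‖a‖ * |b j| ≤ ‖vecMulVec a b‖ := by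
  by_cases hb : b j = 0
  · rw [hb, abs_zero, mul_zero]; exact norm_nonneg _
  have hb' := abs_pos.2 hb
  rw [← le_div_iff₀ hb', pi_norm_le_iff_of_nonneg (by positivity)]
  intro i
  rw [le_div_iff₀ hb', Real.norm_eq_abs, ← abs_mul]
  exact entry_le (vecMulVec a b) i j

lemma vmv_mul (a b c d : Fin 3 → ℝ) : vecMulVec a b * vecMulVec c d = (b ⬝ᵥ c) • vecMulVec a d := by
  ext i j
  rw [Matrix.mul_apply, Fin.sum_univ_three]
  simp [vecMulVec_apply, dotProduct, Fin.sum_univ_three]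
  ring

lemma exp4 (X Y : Mat) : (1 + X) * (1 + Y) = 1 + Y + X + X * Y := by
  rw [add_mul, one_mul, mul_add, mul_one]; abel

lemma arith (a b' C1 κ L B : ℝ) (ha0 : 0 ≤ a) (up : a ≤ C1 * L) (lo : κ / 2 * L ^ 2 ≤ b')
    (hκ0 : 0 < κ) (hL1 : 1 ≤ L) (hLB : 2 * |B| < κ * L) (hC10 : 0 ≤ C1)
    (hB : a ^ 2 ≤ 2 * C1 ^ 2 / κ * b' → b' ≤ B) : False := by
  have fin := hB (by
    calc a ^ 2 ≤ (C1 * L) ^ 2 := by gcongr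
      _ = 2 * C1 ^ 2 / κ * (κ / 2 * L ^ 2) := by field_simp
      _ ≤ 2 * C1 ^ 2 / κ * b' := by gcongr)
  have := le_abs_self B
  have : κ * L * 1 ≤ κ * L * L := by gcongr
  have m8 : κ / 2 * L ^ 2 = κ * L * L / 2 := by ring
  linarith

set_option maxHeartbeats 1000000 in
lemma key (ρ : G →* Mat) (h : RegH ρ) (ι : A2 →* G) (hι : Function.Injective ι)
    (f : Fin 3 → ℝ) (v : A2 → Fin 3 → ℝ)
    (hv : ∀ p, ρ (ι p) = 1 + vecMulVec (v p) f ∧ f ⬝ᵥ v p = 0) (t : G) (q : A2) :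
    f ⬝ᵥ (ρ t *ᵥ v q) = 0 := by
  by_contra hd
  have hf : f ≠ 0 := by rintro rfl; simp at hd
  obtain ⟨j, hj⟩ := Function.ne_iff.1 hf
  have hj : f j ≠ 0 := hj
  have hadd : ∀ a b, v (a * b) = v a + v b := by
    intro a b
    have h1 : ρ (ι (a * b)) = ρ (ι a) * ρ (ι b) := by rw [map_mul, map_mul]
    rw [(hv _).1, (hv a).1, (hv b).1, exp4, vmv_mul, (hv b).2, zero_smul,
      add_zero] at h1
    ext i
    have h2 := congrFun (congrFun h1 i) j
    simp only [Matrix.add_apply, vecMulVec_apply] at h2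
    exact mul_right_cancel₀ hj (by rw [Pi.add_apply]; linarith)
  have hone : v 1 = 0 := by have := hadd 1 1; simpa using this
  have hinv : ∀ a, v a⁻¹ = - v a := by
    intro a
    have := hadd a⁻¹ a
    rw [inv_mul_cancel, hone] at this
    exact eq_neg_of_add_eq_zero_left this.symm
  have hpow : ∀ (a : A2) (n : ℕ), v (a ^ n) = (n : ℝ) • v a := by
    intro a n
    induction n with
    | zero => simp [hone]
    | succ n ih => rw [pow_succ, hadd, ih]; push_cast; rw [add_smul, one_smul]
  have hts : ρ t * ρ t⁻¹ = 1 := mul_inv_rho ρ t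
  set v' : A2 → Fin 3 → ℝ := fun p => ρ t⁻¹ *ᵥ v p with hv'
  set f' : Fin 3 → ℝ := f ᵥ* ρ t with hf'
  set d := f ⬝ᵥ (ρ t *ᵥ v q) with hdd
  have hfd : f' ⬝ᵥ v q = d := by rw [hf', hdd, dotProduct_mulVec]
  have e1 : ∀ p, ρ (t⁻¹ * ι p * t) = 1 + vecMulVec (v' p) f' := by
    intro p
    rw [map_mul, map_mul, (hv p).1, mul_add, add_mul, mul_one, Matrix.mul_vecMulVec,
      Matrix.vecMulVec_mul, mul_eq_one_comm.1 hts]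
  have v'inv : ∀ p, v' p⁻¹ = - v' p := by
    intro p; simp only [hv', hinv, mulVec_neg]
  obtain ⟨B0, hB0⟩ := lat_bdd (fun p => f ⬝ᵥ v' p) (by
    intro a b; simp only [hv', hadd, mulVec_add, dotProduct_add])
  have unb : ∀ K, ∃ p, |f ⬝ᵥ v' p| ≤ B0 ∧ K < ‖v' p‖ := by
    intro K
    by_contra hc
    push Not at hc
    have hinj : Function.Injective (fun p => t⁻¹ * ι p * t) := by
      intro a b hab
      simp only [mul_left_inj, mul_right_inj] at hab
      exact hι hab
    refine hB0 (((h.bdd (‖(1:Mat)‖ + 3 * (K * ‖f'‖))).preimage (f := fun p => t⁻¹ * ι p * t)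
      hinj.injOn).subset ?_)
    intro p hp
    change ‖ρ (t⁻¹ * ι p * t)‖ ≤ _
    rw [e1]
    refine (norm_add_le _ _).trans ?_
    gcongr
    refine (vmv_le _ _).trans ?_
    gcongr
    exact hc p hp
  set b := 3 * ‖f'‖
  set c0 := ‖vecMulVec (v q) f‖
  set e := ‖vecMulVec (v q) f'‖
  set C1 := ‖(1:Mat)‖ + b + 2 * c0 + 2 * |B0| * e with hC1
  have hb0 : 0 ≤ b := by positivity
  have hc00 : 0 ≤ c0 := norm_nonneg _
  have he0 : 0 ≤ e := norm_nonneg _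
  have h10 : 0 ≤ ‖(1:Mat)‖ := norm_nonneg _
  have hC10 : 0 ≤ C1 := by positivity
  set κ := |d| * |f j| with hκ
  have hκ0 : 0 < κ := mul_pos (abs_pos.2 hd) (abs_pos.2 hj)
  obtain ⟨B, hB⟩ := h.bdd_inv (2 * C1 ^ 2 / κ)
  obtain ⟨p, hp1, hp2⟩ := unb (1 + 2 * C1 / κ + 2 * |B| / κ)
  set L := ‖v' p‖ with hL
  have q1 : 0 ≤ 2 * C1 / κ := by positivity
  have q2 : 0 ≤ 2 * |B| / κ := by positivity
  have hL1 : 1 ≤ L := by linarith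
  have hLC : 2 * C1 ≤ κ * L := by
    have : 2 * C1 / κ ≤ L := by linarith
    rw [div_le_iff₀ hκ0] at this; linarith
  have hLB : 2 * |B| < κ * L := by
    have : 2 * |B| / κ < L := by linarith
    rw [div_lt_iff₀ hκ0] at this; linarith
  set k : ℝ := (⌈L⌉₊ : ℝ) with hk
  have k1 : L ≤ k := Nat.le_ceil L
  have k2 : k ≤ 2 * L := by
    have := (Nat.ceil_lt_add_one (a := L) (by linarith)).le
    linarith
  have k0 : 0 ≤ k := by linarith
  have g1 : ρ (ι (q ^ ⌈L⌉₊) * (t⁻¹ * ι p * t)) = 1 + vecMulVec (v' p) f' + k • vecMulVec (v q) f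
      + (k * (f ⬝ᵥ v' p)) • vecMulVec (v q) f' := by
    rw [map_mul, e1, (hv _).1, hpow, smul_vecMulVec, exp4, smul_mul_assoc, vmv_mul, smul_smul]
  have g2 : ρ (ι (q ^ ⌈L⌉₊) * (t⁻¹ * ι p * t))⁻¹ = (k * d) • vecMulVec (v' p) f -
      (vecMulVec (v' p) f' + k • vecMulVec (v q) f - 1) := by
    have : (ι (q ^ ⌈L⌉₊) * (t⁻¹ * ι p * t))⁻¹ = (t⁻¹ * ι p⁻¹ * t) * ι (q ^ ⌈L⌉₊)⁻¹ := by
      simp only [map_inv]; group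
    rw [this, map_mul, e1, (hv _).1, hinv, hpow, v'inv, neg_vecMulVec, neg_vecMulVec, smul_vecMulVec,
      exp4, neg_mul_neg, mul_smul_comm, vmv_mul, smul_smul, hfd]
    abel
  have n1 : ‖vecMulVec (v' p) f'‖ ≤ b * L := (vmv_le _ _).trans (by
    change 3 * (L * ‖f'‖) ≤ 3 * ‖f'‖ * L
    linarith)
  have n2 : ‖k • vecMulVec (v q) f‖ ≤ 2 * L * c0 := by
    rw [norm_smul, Real.norm_of_nonneg k0]
    gcongr
  have n3 : ‖(k * (f ⬝ᵥ v' p)) • vecMulVec (v q) f'‖ ≤ (2 * L) * |B0| * e := by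
    rw [norm_smul, Real.norm_eq_abs, abs_mul, abs_of_nonneg k0]
    have := hp1.trans (le_abs_self _)
    exact mul_le_mul_of_nonneg_right (mul_le_mul k2 this (abs_nonneg _) (by linarith)) he0
  have up : ‖ρ (ι (q ^ ⌈L⌉₊) * (t⁻¹ * ι p * t))‖ ≤ C1 * L := by
    rw [g1]
    refine (norm_add_le _ _).trans ?_
    have := norm_add_le (1 + vecMulVec (v' p) f') (k • vecMulVec (v q) f)
    have := norm_add_le 1 (vecMulVec (v' p) f')
    have : ‖(1:Mat)‖ * 1 ≤ ‖(1:Mat)‖ * L := by gcongr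
    rw [hC1]
    linarith
  have lo : κ / 2 * L ^ 2 ≤ ‖ρ (ι (q ^ ⌈L⌉₊) * (t⁻¹ * ι p * t))⁻¹‖ := by
    rw [g2]
    refine le_trans ?_ (norm_sub_norm_le _ _)
    have m1 : κ * L ^ 2 ≤ ‖(k * d) • vecMulVec (v' p) f‖ := by
      rw [norm_smul, Real.norm_eq_abs, abs_mul, abs_of_nonneg k0]
      calc κ * L ^ 2 = L * |d| * (L * |f j|) := by rw [hκ]; ring
        _ ≤ _ := by
          gcongr
          exact le_vmv _ _ _
    have m2 := norm_sub_le (vecMulVec (v' p) f' + k • vecMulVec (v q) f) 1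
    have m3 := norm_add_le (vecMulVec (v' p) f') (k • vecMulVec (v q) f)
    have m4 : ‖(1:Mat)‖ * 1 ≤ ‖(1:Mat)‖ * L := by gcongr
    have m5 : (2 * C1) * L ≤ κ * L * L := by gcongr
    have m6 : 0 ≤ 2 * |B0| * e * L := by positivity
    have m7 : C1 * L = ‖(1:Mat)‖ * L + b * L + 2 * c0 * L + 2 * |B0| * e * L := by rw [hC1]; ring
    have m8 : κ / 2 * L ^ 2 = κ * L * L / 2 := by ring
    have m9 : κ * L ^ 2 = κ * L * L := by ring
    linarith
  exact arith _ _ C1 κ L B (norm_nonneg _) up lo hκ0 hL1 hLB hC10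
    (hB (ι (q ^ ⌈L⌉₊) * (t⁻¹ * ι p * t)))

end final

section last
open Matrix

abbrev FP := Monoid.Coprod (Multiplicative (ℤ × ℤ)) (Multiplicative ℤ)

def xx : FP := Monoid.Coprod.inl (pt 1 0)
def tt : FP := Monoid.Coprod.inr (Multiplicative.ofAdd 1)

lemma not_comm : ¬ (xx * (tt * xx * tt⁻¹) = (tt * xx * tt⁻¹) * xx) := by
  intro h
  let F : FP →* Equiv.Perm (Fin 3) := Monoid.Coprod.lift
    ((zpowersHom _ (Equiv.swap 0 1)).comp (AddMonoidHom.toMultiplicative (AddMonoidHom.fst ℤ ℤ)))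
    (zpowersHom _ (Equiv.swap 1 2))
  have hx : F xx = Equiv.swap 0 1 := by simp [F, xx, pt]
  have ht : F tt = Equiv.swap 1 2 := by simp [F, tt]
  have := congrArg F h
  simp only [map_mul, map_inv, hx, ht] at this
  revert this
  decide

lemma last (ρ : FP →* Mat) (hi : Function.Injective ρ) (h : RegH ρ)
    (h1 : Type1 (ρ.comp Monoid.Coprod.inl)) : False := by
  obtain ⟨f, v, hv⟩ := h1
  have hk := key ρ h Monoid.Coprod.inl Monoid.Coprod.inl_injective f v hv
  apply not_comm
  apply hi
  have e0 : ρ xx = 1 + vecMulVec (v (pt 1 0)) f := (hv _).1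
  have e1 : ρ (tt * xx * tt⁻¹) = 1 + vecMulVec (ρ tt *ᵥ v (pt 1 0)) (f ᵥ* ρ tt⁻¹) := by
    rw [map_mul, map_mul, e0, mul_add, add_mul, mul_one, Matrix.mul_vecMulVec,
      Matrix.vecMulVec_mul, mul_inv_rho]
  rw [map_mul, map_mul _ (tt * xx * tt⁻¹), e1, e0, exp4, exp4, vmv_mul, vmv_mul, ← dotProduct_mulVec, hk, hk, zero_smul, zero_smul]
  abel

end last
end RegZ2

/-- There is no regular subgroup of SL(3,ℝ) isomorphic to ℤ² ∗ ℤ. -/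
theorem no_regular_Z2_free_Z_in_SL3 :
    ¬ ∃ φ : Monoid.Coprod (Multiplicative (ℤ × ℤ)) (Multiplicative ℤ) →*
        Matrix.SpecialLinearGroup (Fin 3) ℝ,
      Function.Injective φ ∧ IsRegularHom φ := by
  rintro ⟨φ, hi, hr⟩
  let ρ : RegZ2.FP →* RegZ2.Mat :=
    { toFun := fun γ => (φ γ : Matrix (Fin 3) (Fin 3) ℝ)
      map_one' := by simp
      map_mul' := fun a b => by simp }
  have hρi : Function.Injective ρ := fun a b hab => hi (Subtype.ext hab)
  have hρd : ∀ γ, (ρ γ).det = 1 := fun γ => (φ γ).2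
  have hρ : RegZ2.RegH ρ := by
    intro C
    by_contra hinf
    have hinf : Set.Infinite _ := hinf
    have ht := hr (fun n => (hinf.natEmbedding _ n : RegZ2.FP))
      (fun a b hab => (hinf.natEmbedding _).injective (Subtype.ext hab))
    obtain ⟨n, hn⟩ := (ht.eventually (eventually_gt_atTop C)).exists
    have hm := (hinf.natEmbedding _ n).2
    set γ : RegZ2.FP := (hinf.natEmbedding _ n : RegZ2.FP)
    have hn2 : C < frobNorm (ρ γ) ^ 2 / frobNorm (ρ γ⁻¹) := by
      have : ρ γ⁻¹ = ((φ γ)⁻¹ : Matrix.SpecialLinearGroup (Fin 3) ℝ) := by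
        change ((φ γ⁻¹ : Matrix.SpecialLinearGroup (Fin 3) ℝ) : Matrix (Fin 3) (Fin 3) ℝ) = _
        rw [map_inv]
      rw [this]
      exact hn
    rw [RegZ2.frob_eq, RegZ2.frob_eq] at hn2
    exact absurd hm (not_le.2 ((lt_div_iff₀ (RegZ2.norm_pos_rho ρ γ⁻¹)).1 hn2))
  have hinl : Function.Injective (Monoid.Coprod.inl : RegZ2.A2 →* RegZ2.FP) :=
    Monoid.Coprod.inl_injective
  rcases RegZ2.classify _ (hρ.comp Monoid.Coprod.inl hinl) (fun p => hρd _) with h1 | h2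
  · exact RegZ2.last ρ hρi hρ h1
  · refine RegZ2.last (RegZ2.dual ρ) ?_ hρ.dual ?_
    · intro a b hab
      exact inv_injective (hρi (Matrix.transpose_injective hab))
    · obtain ⟨v, f, hv⟩ := h2
      refine ⟨v, fun p => f p⁻¹, fun p => ⟨?_, ?_⟩⟩
      · have := (hv p⁻¹).1
        change (ρ (Monoid.Coprod.inl p)⁻¹).transpose = _
        change ρ (Monoid.Coprod.inl p⁻¹) = _ at this
        rw [← map_inv, this, Matrix.transpose_add, Matrix.transpose_one, Matrix.transpose_vecMulVec]
      · rw [dotProduct_comm]; exact (hv p⁻¹).2
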